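/- In the toy instance with non-monotonic cost matrix c = [[0,0.2,0.3],[0.3,0,0.7],[1.2,1.1,0]], no outcome monotonic policy is optimal: every outcome monotonic policy π (i.e. every π with π(x_1) > π(x_2) > π(x_3), since q_1 > q_2 > q_3) satisfies u(π, 0.1) < 0.6 = u(π_0, 0.1), where π_0 is the policy with π_0(x_1) = 1, π_0(x_2) = 0, π_0(x_3) = 1. -/

import Mathlib

open scoped Classical

/-- The best response of an individual with features `x i` to policy `π` under cost `c`:
the element of `argmax_k (π k - c i k)` with the highest outcome and, among maximizers
with equal outcome, the lowest index.  Since indices are sorted in decreasing order of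
outcome, this is the minimal index among the maximizers. -/
noncomputable def bestResponse {m : ℕ} [NeZero m] (c : Fin m → Fin m → ℝ)
    (π : Fin m → ℝ) (i : Fin m) : Fin m :=
  (Finset.univ.filter (fun k => ∀ l, π l - c i l ≤ π k - c i k)).min' (by
    obtain ⟨k, -, hk⟩ := Finset.exists_max_image Finset.univ (fun k => π k - c i k)
      ⟨i, Finset.mem_univ i⟩
    exact ⟨k, Finset.mem_filter.mpr ⟨Finset.mem_univ k, fun l => hk l (Finset.mem_univ l)⟩⟩)

/-- The utility of a decision policy `π`:  `u(π,γ) = Σ_i P(x_i) · π(x_{br_π(i)}) · (q_{br_π(i)} − γ)`. -/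
noncomputable def utility {m : ℕ} [NeZero m] (P q : Fin m → ℝ) (c : Fin m → Fin m → ℝ)
    (γ : ℝ) (π : Fin m → ℝ) : ℝ :=
  ∑ i, P i * π (bestResponse c π i) * (q (bestResponse c π i) - γ)

/-- A decision policy takes values in `[0,1]`. -/
def IsPolicy {m : ℕ} (π : Fin m → ℝ) : Prop := ∀ i, 0 ≤ π i ∧ π i ≤ 1


/-- The non-monotonic cost matrix of the second toy instance:
`c = [[0,0.2,0.3],[0.3,0,0.7],[1.2,1.1,0]]`. -/
noncomputable def toyCost2 : Fin 3 → Fin 3 → ℝ :=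
  ![![0, 0.2, 0.3], ![0.3, 0, 0.7], ![1.2, 1.1, 0]]

/-- The utility in the second toy instance with `P = (0.1, 0.4, 0.5)`,
`q = (1, 0.7, 0.4)`, `γ = 0.1` and the cost matrix `toyCost2`. -/
noncomputable def toyUtility2 (π : Fin 3 → ℝ) : ℝ :=
  utility ![0.1, 0.4, 0.5] ![1, 0.7, 0.4] toyCost2 0.1 π

theorem bestResponse_le {m : ℕ} [NeZero m] (c : Fin m → Fin m → ℝ) (π : Fin m → ℝ)
    (i l : Fin m) : π l - c i l ≤ π (bestResponse c π i) - c i (bestResponse c π i) := by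
  have h := Finset.min'_mem (Finset.univ.filter (fun k => ∀ l, π l - c i l ≤ π k - c i k)) (by
    obtain ⟨k, -, hk⟩ := Finset.exists_max_image Finset.univ (fun k => π k - c i k)
      ⟨i, Finset.mem_univ i⟩
    exact ⟨k, Finset.mem_filter.mpr ⟨Finset.mem_univ k, fun l => hk l (Finset.mem_univ l)⟩⟩)
  exact (Finset.mem_filter.mp h).2 l

theorem bestResponse_eq_of_forall_lt {m : ℕ} [NeZero m] (c : Fin m → Fin m → ℝ) (π : Fin m → ℝ)
    (i k : Fin m) (h : ∀ l, l ≠ k → π l - c i l < π k - c i k) : bestResponse c π i = k := by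
  by_contra hne
  exact absurd (bestResponse_le c π i k) (not_le.mpr (h _ hne))

/-- In the second toy instance (non-monotonic costs), no outcome monotonic policy is
optimal: every outcome monotonic decision policy `π` (i.e. `q i < q j ↔ π i < π j`,
which here means `π 0 > π 1 > π 2` since `q 0 > q 1 > q 2`) has utility strictly less
than `0.6 = u(π₀, 0.1)` where `π₀ = (1, 0, 1)`. -/
theorem stmt15 :
    toyUtility2 ![1, 0, 1] = 0.6 ∧
    ∀ π : Fin 3 → ℝ, (∀ i, 0 ≤ π i ∧ π i ≤ 1) →
      (∀ i j : Fin 3, (![1, 0.7, 0.4] : Fin 3 → ℝ) i < ![1, 0.7, 0.4] j ↔ π i < π j) →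
      toyUtility2 π < 0.6 := by
  constructor
  · have h0 : bestResponse toyCost2 ![1, 0, 1] 0 = 0 :=
      bestResponse_eq_of_forall_lt _ _ _ _ fun l hl => by
        fin_cases l <;> simp [toyCost2] at hl ⊢ <;> norm_num
    have h1 : bestResponse toyCost2 ![1, 0, 1] 1 = 0 :=
      bestResponse_eq_of_forall_lt _ _ _ _ fun l hl => by
        fin_cases l <;> simp [toyCost2] at hl ⊢ <;> norm_num
    have h2 : bestResponse toyCost2 ![1, 0, 1] 2 = 2 :=
      bestResponse_eq_of_forall_lt _ _ _ _ fun l hl => by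
        fin_cases l <;> simp [toyCost2] at hl ⊢ <;> norm_num
    simp [toyUtility2, utility, Fin.sum_univ_three, h0, h1, h2]
    norm_num
  · intro π hπ hmono
    have h10 : π 1 < π 0 := (hmono 1 0).mp (by simp; norm_num)
    have h21 : π 2 < π 1 := (hmono 2 1).mp (by simp; norm_num)
    have hle := (hπ 0).2
    have hnonneg := (hπ 2).1
    have h0 : bestResponse toyCost2 π 0 = 0 :=
      bestResponse_eq_of_forall_lt _ _ _ _ fun l hl => by
        fin_cases l <;> simp [toyCost2] at hl ⊢ <;> linarith
    have h2 : bestResponse toyCost2 π 2 = 2 :=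
      bestResponse_eq_of_forall_lt _ _ _ _ fun l hl => by
        fin_cases l <;> simp [toyCost2] at hl ⊢ <;> linarith
    have hmax := bestResponse_le toyCost2 π 1 1
    simp only [toyUtility2, utility, Fin.sum_univ_three, h0, h2]
    generalize bestResponse toyCost2 π 1 = b at hmax ⊢
    fin_cases b <;> simp [toyCost2] at hmax ⊢ <;> linarith
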